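/- Let R = (C, Δ) be a generalized root system for a connected basic datum (X, ρ), let x ∈ X and i ≠ j in I, and suppose m := m^x_{ij} = |Δ^x ∩ (ℕ_0 α_i + ℕ_0 α_j)| is finite. Then the alternating product of 2m generators (ς_i^x ς_j)^m = ς_i^x ς_j ς_i ς_j ⋯ (with the implicit superscripts making the composition defined) equals the identity id_x in the Weyl groupoid W(R); equivalently, the alternating product s_i^x s_j^{ρ_i(x)} s_i^{ρ_jρ_i(x)} ⋯ of the corresponding 2m reflections equals the identity of GL(ℤ^I). (These are exactly the Coxeter relations, giving an epimorphism of groupoids from the Coxeter groupoid W(X, ρ, M) onto W(R).) -/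

import Mathlib

open Function

/-- The reflection `s_i` determined by the `i`-th row of a generalized Cartan matrix `C`,
acting on `ℤ^θ`; on the standard basis it is `s_i(α_j) = α_j - C i j • α_i`. -/
def cartanRefl {θ : ℕ} (C : Matrix (Fin θ) (Fin θ) ℤ) (i : Fin θ) :
    (Fin θ → ℤ) → (Fin θ → ℤ) :=
  fun v => v - (∑ j, C i j * v j) • Pi.single i 1

/-- A generalized root system `(C, Δ)` over a connected basic datum `(X, ρ)`. -/
structure GRS (θ : ℕ) (X : Type*) where
  nonempty : Nonempty X
  /-- The basic datum: a family of involutive permutations of `X`. -/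
  ρ : Fin θ → Equiv.Perm X
  ρ_invol : ∀ i, ρ i * ρ i = 1
  /-- Connectedness of the basic datum. -/
  connected : ∀ x y : X, Relation.ReflTransGen (fun a b => ∃ i, ρ i a = b) x y
  /-- The Cartan datum: a bundle of generalized Cartan matrices. -/
  C : X → Matrix (Fin θ) (Fin θ) ℤ
  C_diag : ∀ x i, C x i i = 2
  C_offdiag : ∀ x i j, i ≠ j → C x i j ≤ 0
  C_zero_iff : ∀ x i j, i ≠ j → (C x i j = 0 ↔ C x j i = 0)
  C_compat : ∀ x i j, C (ρ i x) i j = C x i j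
  /-- The bundle of root sets. -/
  Δ : X → Set (Fin θ → ℤ)
  /-- Axiom (1): `Δ^x = Δ^x_+ ∪ Δ^x_-`, where `Δ^x_± = ±(Δ^x ∩ ℕ₀^θ)`. -/
  root_pos_neg : ∀ x, Δ x = (Δ x ∩ {v | ∀ k, 0 ≤ v k}) ∪ ((fun v => -v) '' (Δ x ∩ {v | ∀ k, 0 ≤ v k}))
  /-- Axiom (2): `Δ^x ∩ ℤα_i = {α_i, -α_i}`. -/
  root_simple : ∀ x i, Δ x ∩ {v | ∃ n : ℤ, v = n • (Pi.single i 1 : Fin θ → ℤ)}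
      = {Pi.single i 1, -Pi.single i 1}
  /-- Axiom (3): `s_i^x(Δ^x) = Δ^{ρ_i(x)}`. -/
  root_refl : ∀ x i, cartanRefl (C x) i '' Δ x = Δ (ρ i x)
  /-- Axiom (4): `(ρ_i ρ_j)^{m^x_{ij}}(x) = x` where `m^x_{ij} = |Δ^x ∩ (ℕ₀α_i + ℕ₀α_j)|`. -/
  root_coxeter : ∀ x i j, i ≠ j →
    (Δ x ∩ {v | ∃ p q : ℕ, v = p • (Pi.single i 1 : Fin θ → ℤ) + q • Pi.single j 1}).Finite →
    ((ρ i * ρ j) ^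
      (Δ x ∩ {v | ∃ p q : ℕ, v = p • (Pi.single i 1 : Fin θ → ℤ) + q • Pi.single j 1}).ncard) x = x

namespace GRS

variable {θ : ℕ} {X : Type*} (R : GRS θ X)

/-- The set of positive roots `Δ^x_+` at `x`. -/
def pos (x : X) : Set (Fin θ → ℤ) := {v ∈ R.Δ x | ∀ k, 0 ≤ v k}

/-- Membership in the Weyl groupoid `W(R)`: `Weyl R x g y` says that the triple `(x, g, y)`
belongs to the subgroupoid of `X × GL(ℤ^θ) × X` generated by the `ς_i^x = (x, s_i^x, ρ_i(x))`. -/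
inductive Weyl : X → ((Fin θ → ℤ) → (Fin θ → ℤ)) → X → Prop
  | nil (x : X) : Weyl x _root_.id x
  | cons (x : X) (i : Fin θ) {g : (Fin θ → ℤ) → (Fin θ → ℤ)} {y : X} :
      Weyl (R.ρ i x) g y → Weyl x (cartanRefl (R.C x) i ∘ g) y

/-- Endpoint of the word `ς_{i_1}^x ς_{i_2} ⋯ ς_{i_t}` (with implicit superscripts). -/
def wordEnd : X → List (Fin θ) → X
  | x, [] => x
  | x, i :: l => wordEnd (R.ρ i x) l

/-- The element of `GL(ℤ^θ)` given by the word `ς_{i_1}^x ς_{i_2} ⋯ ς_{i_t}`: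
the composition `s_{i_1}^x ∘ s_{i_2}^{ρ_{i_1}(x)} ∘ ⋯`. -/
def wordMap : X → List (Fin θ) → ((Fin θ → ℤ) → (Fin θ → ℤ))
  | _, [] => _root_.id
  | x, i :: l => cartanRefl (R.C x) i ∘ wordMap (R.ρ i x) l

/-- The length `ℓ(w)` of the element `w = (x, g, y)` of the Weyl groupoid: the least number of
generators needed to express it. -/
noncomputable def len (x : X) (g : (Fin θ → ℤ) → (Fin θ → ℤ)) (y : X) : ℕ :=
  sInf {t | ∃ l : List (Fin θ), l.length = t ∧ R.wordEnd x l = y ∧ R.wordMap x l = g}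

/-- The set of real roots `(Δ^{re})^x` at `x`. -/
def realRoots (x : X) : Set (Fin θ → ℤ) :=
  {v | ∃ (i : Fin θ) (g : (Fin θ → ℤ) → (Fin θ → ℤ)) (y : X), R.Weyl x g y ∧ v = g (Pi.single i 1)}

/-- The generalized root system is finite: its Weyl groupoid is a finite set. -/
def FiniteWeyl : Prop :=
  {p : X × ((Fin θ → ℤ) → (Fin θ → ℤ)) × X | R.Weyl p.1 p.2.1 p.2.2}.Finite

end GRS

namespace GRS

variable {θ : ℕ} {X : Type*} (R : GRS θ X)

theorem cartanRefl_apply_of_ne (C : Matrix (Fin θ) (Fin θ) ℤ) {i k : Fin θ} (h : k ≠ i)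
    (v : Fin θ → ℤ) : cartanRefl C i v k = v k := by
  simp [cartanRefl, h]

theorem cartanRefl_apply_self_of_support (C : Matrix (Fin θ) (Fin θ) ℤ) {i j : Fin θ}
    (hij : i ≠ j) (hC : C i i = 2) {v : Fin θ → ℤ} (hv : ∀ k, k ≠ i → k ≠ j → v k = 0) :
    cartanRefl C i v i = -v i - C i j * v j := by
  have h : ∑ k, C i k * v k = C i i * v i + C i j * v j :=
    Fintype.sum_eq_add i j hij fun k hk => by rw [hv k hk.1 hk.2, mul_zero]
  simp only [cartanRefl, Pi.sub_apply, Pi.smul_apply, Pi.single_eq_same, smul_eq_mul, h, hC]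
  ring

theorem cartanRefl_single_self (C : Matrix (Fin θ) (Fin θ) ℤ) {i : Fin θ} (hC : C i i = 2) :
    cartanRefl C i (Pi.single i 1) = -Pi.single i 1 := by
  have h : ∑ k, C i k * (Pi.single i 1 : Fin θ → ℤ) k = 2 := by
    simp [Pi.single_apply, hC]
  simp only [cartanRefl, h]
  module

/-- The reflection as a linear map. -/
def reflLin (C : Matrix (Fin θ) (Fin θ) ℤ) (i : Fin θ) : (Fin θ → ℤ) →ₗ[ℤ] (Fin θ → ℤ) where
  toFun := cartanRefl C i
  map_add' v w := by
    simp only [cartanRefl, Pi.add_apply, mul_add, Finset.sum_add_distrib]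
    module
  map_smul' c v := by
    have h : ∑ k, C i k * (c • v) k = c * ∑ k, C i k * v k := by
      rw [Finset.mul_sum]
      exact Finset.sum_congr rfl fun k _ => by simp only [Pi.smul_apply, smul_eq_mul]; ring
    simp only [cartanRefl, h, RingHom.id_apply]
    module

theorem cartanRefl_cartanRefl (C : Matrix (Fin θ) (Fin θ) ℤ) {i : Fin θ} (hC : C i i = 2)
    (v : Fin θ → ℤ) : cartanRefl C i (cartanRefl C i v) = v := by
  change reflLin C i (v - (∑ k, C i k * v k) • Pi.single i 1) = v
  rw [map_sub, map_smul]
  change cartanRefl C i v - _ • cartanRefl C i _ = v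
  rw [cartanRefl_single_self C hC]
  simp only [cartanRefl]
  module

theorem cartanRefl_ρ (x : X) (i : Fin θ) :
    cartanRefl (R.C (R.ρ i x)) i = cartanRefl (R.C x) i := by
  funext v
  simp only [cartanRefl, R.C_compat]

theorem ρ_ρ (x : X) (i : Fin θ) : R.ρ i (R.ρ i x) = x := by
  rw [← Equiv.Perm.mul_apply, R.ρ_invol, Equiv.Perm.one_apply]

theorem refl_mem {x : X} {v : Fin θ → ℤ} (i : Fin θ) (hv : v ∈ R.Δ x) :
    cartanRefl (R.C x) i v ∈ R.Δ (R.ρ i x) := by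
  rw [← R.root_refl]
  exact Set.mem_image_of_mem _ hv

theorem refl_mem' {x : X} {v : Fin θ → ℤ} {i : Fin θ} (hv : v ∈ R.Δ (R.ρ i x)) :
    cartanRefl (R.C x) i v ∈ R.Δ x := by
  have h := R.refl_mem i hv
  rwa [cartanRefl_ρ, ρ_ρ] at h

theorem simple_mem (x : X) (i : Fin θ) : (Pi.single i 1 : Fin θ → ℤ) ∈ R.Δ x := by
  have h : (Pi.single i 1 : Fin θ → ℤ) ∈ ({Pi.single i 1, -Pi.single i 1} : Set (Fin θ → ℤ)) :=
    Or.inl rfl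
  rw [← R.root_simple x i] at h
  exact h.1

theorem nonneg_or_nonpos {x : X} {v : Fin θ → ℤ} (hv : v ∈ R.Δ x) : 0 ≤ v ∨ v ≤ 0 := by
  rw [R.root_pos_neg] at hv
  rcases hv with hv | ⟨u, hu, rfl⟩
  · exact Or.inl hv.2
  · exact Or.inr (neg_nonpos.2 hu.2)

theorem neg_mem {x : X} {v : Fin θ → ℤ} (hv : v ∈ R.Δ x) : -v ∈ R.Δ x := by
  have hv' := hv
  rw [R.root_pos_neg] at hv'
  rcases hv' with hv' | ⟨u, hu, rfl⟩
  · rw [R.root_pos_neg]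
    exact Or.inr ⟨v, hv', rfl⟩
  · simpa using hu.1

theorem ne_zero {x : X} {v : Fin θ → ℤ} (i : Fin θ) (hv : v ∈ R.Δ x) : v ≠ 0 := by
  rintro rfl
  have h : (0 : Fin θ → ℤ) ∈ R.Δ x ∩ {v | ∃ n : ℤ, v = n • (Pi.single i 1 : Fin θ → ℤ)} :=
    ⟨hv, 0, by simp⟩
  rw [R.root_simple] at h
  rcases h with h | h
  all_goals simpa using congrFun h i

/-- The linear map underlying `wordMap`. -/
def wordLin : X → List (Fin θ) → ((Fin θ → ℤ) →ₗ[ℤ] (Fin θ → ℤ))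
  | _, [] => LinearMap.id
  | x, i :: l => reflLin (R.C x) i ∘ₗ wordLin (R.ρ i x) l

theorem coe_wordLin (x : X) (l : List (Fin θ)) : ⇑(R.wordLin x l) = R.wordMap x l := by
  induction l generalizing x with
  | nil => rfl
  | cons i l ih =>
    rw [wordMap, ← ih]
    rfl

theorem wordLin_cons (x : X) (i : Fin θ) (l : List (Fin θ)) (v : Fin θ → ℤ) :
    R.wordLin x (i :: l) v = cartanRefl (R.C x) i (R.wordLin (R.ρ i x) l v) := rfl

theorem wordEnd_append (x : X) (l l' : List (Fin θ)) :
    R.wordEnd x (l ++ l') = R.wordEnd (R.wordEnd x l) l' := by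
  induction l generalizing x with
  | nil => rfl
  | cons i l ih => exact ih _

theorem wordLin_append (x : X) (l l' : List (Fin θ)) (v : Fin θ → ℤ) :
    R.wordLin x (l ++ l') v = R.wordLin x l (R.wordLin (R.wordEnd x l) l' v) := by
  induction l generalizing x with
  | nil => rfl
  | cons i l ih => rw [List.cons_append, wordLin_cons, ih]; rfl

theorem wordEnd_reverse (x : X) (l : List (Fin θ)) :
    R.wordEnd (R.wordEnd x l) l.reverse = x := by
  induction l generalizing x with
  | nil => rfl
  | cons i l ih =>
    rw [List.reverse_cons, wordEnd_append]
    change R.ρ i (R.wordEnd (R.wordEnd (R.ρ i x) l) l.reverse) = x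
    rw [ih, ρ_ρ]

theorem wordLin_reverse (x : X) (l : List (Fin θ)) (v : Fin θ → ℤ) :
    R.wordLin x l (R.wordLin (R.wordEnd x l) l.reverse v) = v := by
  induction l generalizing x v with
  | nil => rfl
  | cons i l ih =>
    rw [List.reverse_cons, wordLin_append, wordEnd, wordLin_cons, ih, wordEnd_reverse]
    change cartanRefl (R.C x) i (cartanRefl (R.C (R.ρ i x)) i v) = v
    rw [cartanRefl_ρ, cartanRefl_cartanRefl _ (R.C_diag x i)]

theorem wordLin_reverse' (x : X) (l : List (Fin θ)) (v : Fin θ → ℤ) :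
    R.wordLin (R.wordEnd x l) l.reverse (R.wordLin x l v) = v := by
  have h := R.wordLin_reverse (R.wordEnd x l) l.reverse v
  rwa [wordEnd_reverse, List.reverse_reverse] at h

theorem wordLin_mem {x : X} {l : List (Fin θ)} {v : Fin θ → ℤ} (hv : v ∈ R.Δ (R.wordEnd x l)) :
    R.wordLin x l v ∈ R.Δ x := by
  induction l generalizing x with
  | nil => exact hv
  | cons i l ih => exact R.refl_mem' (ih hv)

theorem wordLin_apply_of_ne {i j k : Fin θ} (hi : k ≠ i) (hj : k ≠ j) {l : List (Fin θ)}
    (hl : ∀ a ∈ l, a = i ∨ a = j) (x : X) (v : Fin θ → ℤ) : R.wordLin x l v k = v k := by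
  induction l generalizing x with
  | nil => rfl
  | cons a l ih =>
    rw [wordLin_cons, cartanRefl_apply_of_ne, ih fun b hb => hl b (by simp [hb])]
    rcases hl a (by simp) with rfl | rfl <;> assumption

theorem wordLin_snoc_simple (x : X) (l : List (Fin θ)) (a : Fin θ) :
    R.wordLin x (l ++ [a]) (Pi.single a 1) = -R.wordLin x l (Pi.single a 1) := by
  rw [wordLin_append, ← map_neg]
  congr 1
  exact cartanRefl_single_self _ (R.C_diag _ a)

/-- The determinant of a word in two letters, acting on the span of two simple roots. -/
theorem wordLin_det {i j : Fin θ} (hij : i ≠ j) {l : List (Fin θ)}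
    (hl : ∀ a ∈ l, a = i ∨ a = j) (x : X) :
    R.wordLin x l (Pi.single i 1) i * R.wordLin x l (Pi.single j 1) j
      - R.wordLin x l (Pi.single i 1) j * R.wordLin x l (Pi.single j 1) i = (-1) ^ l.length := by
  induction l generalizing x with
  | nil => simp [wordLin, hij, hij.symm]
  | cons a l ih =>
    have hl' : ∀ b ∈ l, b = i ∨ b = j := fun b hb => hl b (by simp [hb])
    have hs : ∀ b, (b = i ∨ b = j) → ∀ k, k ≠ i → k ≠ j →
        R.wordLin (R.ρ a x) l (Pi.single b 1) k = 0 := fun b hb k hi hj => by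
      rw [R.wordLin_apply_of_ne hi hj hl', Pi.single_eq_of_ne]
      rcases hb with rfl | rfl <;> assumption
    have hs' : ∀ b, (b = i ∨ b = j) → ∀ k, k ≠ j → k ≠ i →
        R.wordLin (R.ρ a x) l (Pi.single b 1) k = 0 := fun b hb k hj hi => hs b hb k hi hj
    have ih := ih hl' (R.ρ a x)
    simp only [wordLin_cons, List.length_cons, pow_succ, ← ih]
    rcases hl a (by simp) with rfl | rfl
    · rw [cartanRefl_apply_of_ne _ hij.symm, cartanRefl_apply_of_ne _ hij.symm,
        cartanRefl_apply_self_of_support _ hij (R.C_diag _ _) (hs _ (Or.inl rfl)),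
        cartanRefl_apply_self_of_support _ hij (R.C_diag _ _) (hs _ (Or.inr rfl))]
      ring
    · rw [cartanRefl_apply_of_ne _ hij, cartanRefl_apply_of_ne _ hij,
        cartanRefl_apply_self_of_support _ hij.symm (R.C_diag _ _) (hs' _ (Or.inl rfl)),
        cartanRefl_apply_self_of_support _ hij.symm (R.C_diag _ _) (hs' _ (Or.inr rfl))]
      ring

/-- The positive roots at `x` in the span of two simple roots. -/
def pairPos (i j : Fin θ) (x : X) : Set (Fin θ → ℤ) :=
  {v | v ∈ R.Δ x ∧ 0 ≤ v ∧ ∀ k, k ≠ i → k ≠ j → v k = 0}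

theorem pairPos_comm (i j : Fin θ) (x : X) : R.pairPos i j x = R.pairPos j i x := by
  ext v
  exact and_congr_right' (and_congr_right' ⟨fun h k hj hi => h k hi hj, fun h k hi hj => h k hj hi⟩)

theorem eq_of_support {i j : Fin θ} (hij : i ≠ j) {v : Fin θ → ℤ}
    (hv : ∀ k, k ≠ i → k ≠ j → v k = 0) :
    v = v i • (Pi.single i 1 : Fin θ → ℤ) + v j • Pi.single j 1 := by
  funext k
  by_cases hi : k = i
  · subst hi; simp [hij]
  · by_cases hj : k = j
    · subst hj; simp [hi]
    · simp [hv k hi hj, hi, hj]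

theorem inter_eq_pairPos {i j : Fin θ} (hij : i ≠ j) (x : X) :
    R.Δ x ∩ {v | ∃ p q : ℕ, v = p • (Pi.single i 1 : Fin θ → ℤ) + q • Pi.single j 1}
      = R.pairPos i j x := by
  ext v
  refine and_congr_right' ⟨?_, fun h => ⟨(v i).toNat, (v j).toNat, ?_⟩⟩
  · rintro ⟨p, q, rfl⟩
    refine ⟨add_nonneg (nsmul_nonneg ?_ _) (nsmul_nonneg ?_ _), fun k hi hj => by simp [hi, hj]⟩ <;>
      simp
  · conv_lhs => rw [eq_of_support hij h.2]
    rw [← natCast_zsmul, ← natCast_zsmul, Int.toNat_of_nonneg (h.1 i), Int.toNat_of_nonneg (h.1 j)]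

theorem simple_mem_pairPos {i j a : Fin θ} (ha : a = i ∨ a = j) (x : X) :
    (Pi.single a 1 : Fin θ → ℤ) ∈ R.pairPos i j x := by
  refine ⟨R.simple_mem x a, by simp, fun k hi hj => Pi.single_eq_of_ne ?_ _⟩
  rcases ha with rfl | rfl <;> assumption

theorem not_nonpos_of_mem_pairPos {i j : Fin θ} {x : X} {v : Fin θ → ℤ}
    (hv : v ∈ R.pairPos i j x) : ¬ v ≤ 0 :=
  fun h => R.ne_zero i hv.1 (le_antisymm h hv.2.1)

theorem refl_mem_pairPos_left {i j : Fin θ} (hij : i ≠ j) {x : X} {v : Fin θ → ℤ}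
    (hv : v ∈ R.pairPos i j x) (hne : v ≠ Pi.single i 1) :
    cartanRefl (R.C x) i v ∈ R.pairPos i j (R.ρ i x) := by
  refine ⟨R.refl_mem i hv.1, ?_, fun k hi hj => by
    rw [cartanRefl_apply_of_ne _ hi, hv.2.2 k hi hj]⟩
  refine (R.nonneg_or_nonpos (R.refl_mem i hv.1)).resolve_right fun hneg => hne ?_
  have hj : v j = 0 := le_antisymm
    (by simpa [cartanRefl_apply_of_ne _ hij.symm] using hneg j) (hv.2.1 j)
  have h : v ∈ R.Δ x ∩ {v | ∃ n : ℤ, v = n • (Pi.single i 1 : Fin θ → ℤ)} :=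
    ⟨hv.1, v i, by simpa [hj] using eq_of_support hij hv.2.2⟩
  rw [R.root_simple] at h
  refine h.resolve_right fun h => ?_
  have h' := hv.2.1 i
  rw [Set.mem_singleton_iff.1 h] at h'
  simp at h'

theorem refl_mem_pairPos {i j a : Fin θ} (hij : i ≠ j) (ha : a = i ∨ a = j) {x : X}
    {v : Fin θ → ℤ} (hv : v ∈ R.pairPos i j x) (hne : v ≠ Pi.single a 1) :
    cartanRefl (R.C x) a v ∈ R.pairPos i j (R.ρ a x) := by
  rcases ha with rfl | rfl
  · exact R.refl_mem_pairPos_left hij hv hne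
  · rw [pairPos_comm] at hv ⊢
    exact R.refl_mem_pairPos_left hij.symm hv hne

/-- The positive roots in the span of two simple roots made negative by the inverse of a word. -/
def inversions (i j : Fin θ) (x : X) (l : List (Fin θ)) : Set (Fin θ → ℤ) :=
  {v | v ∈ R.pairPos i j x ∧ ∃ u ∈ R.pairPos i j (R.wordEnd x l), R.wordLin x l u = -v}

theorem wordLin_mem_pairPos {i j : Fin θ} {x : X} {l : List (Fin θ)}
    (hl : ∀ a ∈ l, a = i ∨ a = j) {v : Fin θ → ℤ} (hv : v ∈ R.pairPos i j (R.wordEnd x l))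
    (h : 0 ≤ R.wordLin x l v) : R.wordLin x l v ∈ R.pairPos i j x :=
  ⟨R.wordLin_mem hv.1, h, fun k hi hj => by
    rw [R.wordLin_apply_of_ne hi hj hl, hv.2.2 k hi hj]⟩

theorem wordLin_notMem_inversions {i j : Fin θ} {x : X} {l : List (Fin θ)} {v : Fin θ → ℤ}
    (hv : v ∈ R.pairPos i j (R.wordEnd x l)) : R.wordLin x l v ∉ R.inversions i j x l := by
  rintro ⟨-, u, hu, h⟩
  have h' := congrArg (R.wordLin (R.wordEnd x l) l.reverse) h
  rw [map_neg, wordLin_reverse', wordLin_reverse'] at h'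
  exact R.not_nonpos_of_mem_pairPos hu (h' ▸ neg_nonpos.2 hv.2.1)

theorem inversions_snoc {i j a : Fin θ} (hij : i ≠ j) (ha : a = i ∨ a = j) {x : X}
    {l : List (Fin θ)} (hl : ∀ a ∈ l, a = i ∨ a = j)
    (hpos : 0 ≤ R.wordLin x l (Pi.single a 1)) :
    R.inversions i j x (l ++ [a])
      = insert (R.wordLin x l (Pi.single a 1)) (R.inversions i j x l) := by
  have hend : R.wordEnd x (l ++ [a]) = R.ρ a (R.wordEnd x l) := R.wordEnd_append x l [a]
  have hlin : ∀ u, R.wordLin x (l ++ [a]) u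
      = R.wordLin x l (cartanRefl (R.C (R.wordEnd x l)) a u) := R.wordLin_append x l [a]
  ext v
  constructor
  · rintro ⟨hv, u, hu, h⟩
    by_cases hua : u = Pi.single a 1
    · subst hua
      rw [wordLin_snoc_simple, neg_inj] at h
      exact Or.inl h.symm
    · rw [hend] at hu
      have := R.refl_mem_pairPos hij ha hu hua
      rw [cartanRefl_ρ, ρ_ρ] at this
      exact Or.inr ⟨hv, _, this, hlin u ▸ h⟩
  · rintro (rfl | ⟨hv, u, hu, h⟩)
    · exact ⟨R.wordLin_mem_pairPos hl (R.simple_mem_pairPos ha _) hpos, Pi.single a 1,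
        R.simple_mem_pairPos ha _, R.wordLin_snoc_simple x l a⟩
    · have hua : u ≠ Pi.single a 1 := by
        rintro rfl
        exact R.not_nonpos_of_mem_pairPos hv (by rw [← neg_nonneg, ← h]; exact hpos)
      refine ⟨hv, _, hend ▸ R.refl_mem_pairPos hij ha hu hua, ?_⟩
      rw [hlin, cartanRefl_cartanRefl _ (R.C_diag _ a), h]

theorem inversions_eq_of_nonpos {i j : Fin θ} (hij : i ≠ j) {x : X} {l : List (Fin θ)}
    (hl : ∀ a ∈ l, a = i ∨ a = j) (hi : R.wordLin x l (Pi.single i 1) ≤ 0)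
    (hj : R.wordLin x l (Pi.single j 1) ≤ 0) : R.inversions i j x l = R.pairPos i j x := by
  refine Set.Subset.antisymm (fun v hv => hv.1) fun v hv => ⟨hv, ?_⟩
  set u := R.wordLin (R.wordEnd x l) l.reverse v with hu
  have huv : R.wordLin x l u = v := R.wordLin_reverse x l v
  have hmem : u ∈ R.Δ (R.wordEnd x l) := R.wordLin_mem (by rw [wordEnd_reverse]; exact hv.1)
  have hsupp : ∀ k, k ≠ i → k ≠ j → u k = 0 := fun k hki hkj => by
    rw [hu, R.wordLin_apply_of_ne hki hkj (by simpa using hl), hv.2.2 k hki hkj]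
  rcases R.nonneg_or_nonpos hmem with h | h
  · refine (R.not_nonpos_of_mem_pairPos hv ?_).elim
    rw [← huv, eq_of_support hij hsupp, map_add, map_smul, map_smul]
    exact add_nonpos (smul_nonpos_of_nonneg_of_nonpos (h i) hi)
      (smul_nonpos_of_nonneg_of_nonpos (h j) hj)
  · exact ⟨-u, ⟨R.neg_mem hmem, neg_nonneg.2 h, fun k hki hkj => by simp [hsupp k hki hkj]⟩,
      by rw [map_neg, huv]⟩

/-- The alternating word `i, j, i, …` of length `n`. -/
def altWord (i j : Fin θ) (n : ℕ) : List (Fin θ) :=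
  (List.range n).map fun k => if k % 2 = 0 then i else j

theorem mem_altWord {i j a : Fin θ} {n : ℕ} (h : a ∈ altWord i j n) : a = i ∨ a = j := by
  obtain ⟨k, -, rfl⟩ := List.mem_map.1 h
  split_ifs <;> simp

theorem altWord_succ (i j : Fin θ) (n : ℕ) :
    altWord i j (n + 1) = altWord i j n ++ [if n % 2 = 0 then i else j] := by
  simp [altWord, List.range_succ]

theorem altWord_two_mul (i j : Fin θ) (m : ℕ) :
    altWord i j (2 * m) = altWord i j m ++ (altWord j i m).reverse := by
  refine List.ext_getElem (by simp [altWord]; omega) fun k h₁ h₂ => ?_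
  have hk : k < 2 * m := by simpa [altWord] using h₁
  rw [List.getElem_append]
  split_ifs with h
  · simp [altWord]
  · have hm : m ≤ k := by simpa [altWord] using h
    simp only [altWord, List.getElem_map, List.getElem_range, List.getElem_reverse,
      List.length_map, List.length_range]
    split_ifs <;> first | rfl | omega

theorem ncard_inversions_altWord {i j : Fin θ} (hij : i ≠ j) {x : X}
    (hfin : (R.pairPos i j x).Finite) {n : ℕ} (hn : n ≤ (R.pairPos i j x).ncard) :
    (R.inversions i j x (altWord i j n)).ncard = n ∧
      (n ≠ 0 → R.wordLin x (altWord i j n) (Pi.single (if n % 2 = 0 then j else i) 1) ≤ 0) := by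
  induction n with
  | zero =>
    refine ⟨?_, fun h => (h rfl).elim⟩
    rw [Set.ncard_eq_zero (hfin.subset fun v hv => hv.1), Set.eq_empty_iff_forall_notMem]
    rintro v ⟨hv, u, hu, h⟩
    exact R.not_nonpos_of_mem_pairPos hu
      ((show u = -v from h) ▸ neg_nonpos.2 hv.2.1)
  | succ n ih =>
    obtain ⟨hcard, hneg⟩ := ih (by omega)
    set a := if n % 2 = 0 then i else j with ha
    have hl : ∀ b ∈ altWord i j n, b = i ∨ b = j := fun b => mem_altWord
    have haij : a = i ∨ a = j := by rw [ha]; split_ifs <;> simp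
    have hpos : 0 ≤ R.wordLin x (altWord i j n) (Pi.single a 1) := by
      refine (R.nonneg_or_nonpos (R.wordLin_mem (R.simple_mem _ a))).resolve_right fun h => ?_
      rcases eq_or_ne n 0 with rfl | hn0
      · exact R.not_nonpos_of_mem_pairPos (R.simple_mem_pairPos haij x) h
      · have heq : R.inversions i j x (altWord i j n) = R.pairPos i j x := by
          have := hneg hn0
          by_cases hp : n % 2 = 0
          · simp only [ha, hp, if_true] at h this
            exact R.inversions_eq_of_nonpos hij hl h this
          · simp only [ha, hp, if_false] at h this
            exact R.inversions_eq_of_nonpos hij hl this h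
        rw [heq] at hcard
        omega
    rw [altWord_succ, ← ha]
    refine ⟨?_, fun _ => ?_⟩
    · rw [R.inversions_snoc hij haij hl hpos, Set.ncard_insert_of_notMem
        (R.wordLin_notMem_inversions (R.simple_mem_pairPos haij _))
        (hfin.subset fun v hv => hv.1), hcard]
    · have : (if (n + 1) % 2 = 0 then j else i) = a := by
        rw [ha]; split_ifs <;> first | rfl | omega
      rw [this, wordLin_snoc_simple]
      exact neg_nonpos.2 hpos

theorem inversions_altWord {i j : Fin θ} (hij : i ≠ j) {x : X}
    (hfin : (R.pairPos i j x).Finite) :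
    R.inversions i j x (altWord i j (R.pairPos i j x).ncard) = R.pairPos i j x :=
  Set.eq_of_subset_of_ncard_le (fun _ hv => hv.1)
    (R.ncard_inversions_altWord hij hfin le_rfl).1.ge hfin

theorem inversions_comm (i j : Fin θ) (x : X) (l : List (Fin θ)) :
    R.inversions i j x l = R.inversions j i x l := by
  simp only [inversions, pairPos_comm R i j]

/-- If two words with the same endpoints invert all positive roots in the span of two simple
roots, their quotient permutes these positive roots. -/
theorem wordLin_append_reverse_mem_pairPos {i j : Fin θ} {x : X} {l l' : List (Fin θ)}
    (hl : ∀ a ∈ l, a = i ∨ a = j) (hend : R.wordEnd x l' = R.wordEnd x l)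
    (h : R.inversions i j x l = R.pairPos i j x) (h' : R.inversions i j x l' = R.pairPos i j x)
    {v : Fin θ → ℤ} (hv : v ∈ R.pairPos i j x) :
    R.wordLin x (l ++ l'.reverse) v ∈ R.pairPos i j x := by
  rw [← h'] at hv
  obtain ⟨hv, u, hu, huv⟩ := hv
  have hu' : R.wordLin (R.wordEnd x l) l'.reverse v = -u := by
    rw [← neg_eq_iff_eq_neg.2 huv, map_neg, ← hend, wordLin_reverse']
  rw [wordLin_append, hu', map_neg]
  have hm : u ∈ R.pairPos i j (R.wordEnd x l) := hend ▸ hu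
  have hneg : R.wordLin x l u ≤ 0 := by
    refine (R.nonneg_or_nonpos (R.wordLin_mem hm.1)).resolve_left fun hp => ?_
    refine R.wordLin_notMem_inversions hm ?_
    rw [h]
    exact R.wordLin_mem_pairPos hl hm hp
  exact ⟨R.neg_mem (R.wordLin_mem hm.1), neg_nonneg.2 hneg, fun k hi hj => by
    rw [Pi.neg_apply, R.wordLin_apply_of_ne hi hj hl, hm.2.2 k hi hj, neg_zero]⟩

theorem wordEnd_altWord_two_mul (i j : Fin θ) (x : X) (n : ℕ) :
    R.wordEnd x (altWord i j (2 * n)) = ((R.ρ j * R.ρ i) ^ n) x := by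
  induction n with
  | zero => rfl
  | succ n ih =>
    rw [show 2 * (n + 1) = 2 * n + 1 + 1 by ring, altWord_succ, altWord_succ, wordEnd_append,
      wordEnd_append, ih, pow_succ']
    simp [wordEnd]

/-- A linear automorphism and its inverse, both given by closed words in two letters, are trivial
if they preserve the positive roots in the span of these letters and have determinant one. -/
theorem wordLin_eq_id {i j : Fin θ} (hij : i ≠ j) {x : X} {l : List (Fin θ)}
    (hl : ∀ a ∈ l, a = i ∨ a = j) (heven : Even l.length) (hend : R.wordEnd x l = x)
    (h : ∀ v ∈ R.pairPos i j x, R.wordLin x l v ∈ R.pairPos i j x)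
    (h' : ∀ v ∈ R.pairPos i j x, R.wordLin x l.reverse v ∈ R.pairPos i j x) :
    R.wordLin x l = LinearMap.id := by
  set w := R.wordLin x l
  set w' := R.wordLin x l.reverse
  have hww : ∀ v, w (w' v) = v := fun v => by
    have := R.wordLin_reverse x l v
    rwa [hend] at this
  have hdet := R.wordLin_det hij hl x
  rw [heven.neg_one_pow] at hdet
  change w _ i * w _ j - w _ j * w _ i = 1 at hdet
  have hwi := h _ (R.simple_mem_pairPos (Or.inl rfl) x)
  have hwj := h _ (R.simple_mem_pairPos (Or.inr rfl) x)
  have hwi' := h' _ (R.simple_mem_pairPos (Or.inl rfl) x)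
  have hwj' := h' _ (R.simple_mem_pairPos (Or.inr rfl) x)
  have key : ∀ v, (∀ k, k ≠ i → k ≠ j → v k = 0) → ∀ k,
      w v k = v i * w (Pi.single i 1) k + v j * w (Pi.single j 1) k := fun v hv k => by
    conv_lhs => rw [eq_of_support hij hv]
    rw [map_add, map_smul, map_smul]
    rfl
  have e₁ := key _ hwi'.2.2 i
  have e₂ := key _ hwi'.2.2 j
  have e₃ := key _ hwj'.2.2 i
  have e₄ := key _ hwj'.2.2 j
  simp only [hww, Pi.single_eq_same, Pi.single_eq_of_ne hij, Pi.single_eq_of_ne hij.symm]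
    at e₁ e₂ e₃ e₄
  have hfix : w (Pi.single i 1) = Pi.single i 1 ∧ w (Pi.single j 1) = Pi.single j 1 := by
    have a0 := hwi.2.1 i
    have b0 := hwi.2.1 j
    have c0 := hwj.2.1 i
    have d0 := hwj.2.1 j
    have a0' := hwi'.2.1 i
    have b0' := hwi'.2.1 j
    have c0' := hwj'.2.1 i
    have d0' := hwj'.2.1 j
    have ei := eq_of_support hij hwi.2.2
    have ej := eq_of_support hij hwj.2.2
    simp only [Pi.zero_apply] at a0 b0 c0 d0 a0' b0' c0' d0'
    generalize w (Pi.single i 1) i = a at *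
    generalize w (Pi.single i 1) j = b at *
    generalize w (Pi.single j 1) i = c at *
    generalize w (Pi.single j 1) j = d at *
    generalize w' (Pi.single i 1) i = a' at *
    generalize w' (Pi.single i 1) j = b' at *
    generalize w' (Pi.single j 1) i = c' at *
    generalize w' (Pi.single j 1) j = d' at *
    have had : 0 < a * d := by nlinarith [mul_nonneg b0 c0]
    have ha : 0 < a := pos_of_mul_pos_left had d0
    have hd : 0 < d := pos_of_mul_pos_right had a0
    have hb' : b' = 0 := by
      have : b' * d = 0 := by nlinarith [mul_nonneg a0' b0, mul_nonneg b0' d0]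
      exact (mul_eq_zero.1 this).resolve_right hd.ne'
    have hc' : c' = 0 := by
      have : c' * a = 0 := by nlinarith [mul_nonneg c0' a0, mul_nonneg d0' c0]
      exact (mul_eq_zero.1 this).resolve_right ha.ne'
    subst hb' hc'
    simp only [zero_mul, add_zero, zero_add] at e₁ e₂ e₃ e₄
    have ha1 : a = 1 := Int.eq_one_of_mul_eq_one_left a0 e₁.symm
    have hd1 : d = 1 := Int.eq_one_of_mul_eq_one_left d0 e₄.symm
    subst ha1 hd1
    have hb : b = 0 := by
      rcases mul_eq_zero.1 e₂.symm with rfl | hb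
      · simp at e₁
      · exact hb
    have hc : c = 0 := by
      rcases mul_eq_zero.1 e₃.symm with rfl | hc
      · simp at e₄
      · exact hc
    subst hb hc
    exact ⟨by simpa using ei, by simpa using ej⟩
  refine (Pi.basisFun ℤ (Fin θ)).ext fun k => ?_
  simp only [Pi.basisFun_apply, LinearMap.id_apply]
  by_cases hi : k = i
  · rw [hi, hfix.1]
  by_cases hj : k = j
  · rw [hj, hfix.2]
  have hl' : ∀ a ∈ l.reverse, a = i ∨ a = j := by simpa using hl
  have hnn : ∀ l₁ : List (Fin θ), (∀ a ∈ l₁, a = i ∨ a = j) →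
      0 ≤ R.wordLin x l₁ (Pi.single k 1) := fun l₁ hl₁ => by
    refine (R.nonneg_or_nonpos (R.wordLin_mem (R.simple_mem _ k))).resolve_right fun hneg => ?_
    have := hneg k
    rw [R.wordLin_apply_of_ne hi hj hl₁] at this
    simp at this
  have hn : 0 ≤ w (Pi.single k 1) := hnn l hl
  have hn' : 0 ≤ w' (Pi.single k 1) := hnn _ hl'
  have hsupp : ∀ t, t ≠ i → t ≠ j → (w' (Pi.single k 1) - (Pi.single k 1 : Fin θ → ℤ)) t = 0 :=
    fun t hti htj => by
      rw [Pi.sub_apply, sub_eq_zero]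
      exact R.wordLin_apply_of_ne hti htj hl' x _
  have hsub := congrArg w (eq_of_support hij hsupp)
  rw [map_sub, hww, map_add, map_smul, map_smul, hfix.1, hfix.2] at hsub
  funext t
  by_cases hti : t = i
  · subst hti
    have h₁ := congrFun hsub t
    have h₂ := hn t
    have h₃ := hn' t
    simp [hij, Ne.symm hi] at h₁ h₂ h₃ ⊢
    omega
  by_cases htj : t = j
  · subst htj
    have h₁ := congrFun hsub t
    have h₂ := hn t
    have h₃ := hn' t
    simp [hij.symm, Ne.symm hj] at h₁ h₂ h₃ ⊢
    omega
  exact R.wordLin_apply_of_ne hti htj hl x _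

end GRS

/-- If `m = m^x_{ij} = |Δ^x ∩ (ℕ₀α_i + ℕ₀α_j)|` is finite, then the alternating
product of `2m` generators `(ς_i^x ς_j)^m = ς_i^x ς_j ς_i ς_j ⋯` (with implicit superscripts)
is the identity `id_x` of the Weyl groupoid: both its endpoint is `x` and the alternating
product of the corresponding `2m` reflections is the identity of `GL(ℤ^θ)`. -/
theorem stmt4 {θ : ℕ} {X : Type*} (R : GRS θ X) (x : X) (i j : Fin θ) (hij : i ≠ j)
    (hfin : (R.Δ x ∩ {v | ∃ p q : ℕ,
      v = p • (Pi.single i 1 : Fin θ → ℤ) + q • Pi.single j 1}).Finite) :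
    letI m : ℕ := (R.Δ x ∩ {v | ∃ p q : ℕ,
      v = p • (Pi.single i 1 : Fin θ → ℤ) + q • Pi.single j 1}).ncard
    letI l : List (Fin θ) := (List.range (2 * m)).map (fun k => if k % 2 = 0 then i else j)
    R.wordEnd x l = x ∧ R.wordMap x l = _root_.id := by
  rw [R.inter_eq_pairPos hij] at hfin ⊢
  set m := (R.pairPos i j x).ncard with hm
  change R.wordEnd x (GRS.altWord i j (2 * m)) = x ∧
    R.wordMap x (GRS.altWord i j (2 * m)) = _root_.id
  have hend : R.wordEnd x (GRS.altWord i j (2 * m)) = x := by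
    have hcox := R.root_coxeter x i j hij (by rwa [R.inter_eq_pairPos hij])
    rw [R.inter_eq_pairPos hij, ← hm] at hcox
    have hinv : R.ρ j * R.ρ i = (R.ρ i * R.ρ j)⁻¹ := by
      rw [mul_inv_rev, ← eq_inv_of_mul_eq_one_left (R.ρ_invol i),
        ← eq_inv_of_mul_eq_one_left (R.ρ_invol j)]
    rw [R.wordEnd_altWord_two_mul, hinv, inv_pow, Equiv.Perm.inv_eq_iff_eq, hcox]
  refine ⟨hend, ?_⟩
  have h₁ : R.inversions i j x (GRS.altWord i j m) = R.pairPos i j x :=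
    R.inversions_altWord hij hfin
  have h₂ : R.inversions i j x (GRS.altWord j i m) = R.pairPos i j x := by
    rw [R.inversions_comm, R.pairPos_comm, hm, R.pairPos_comm]
    exact R.inversions_altWord hij.symm (by rwa [R.pairPos_comm])
  have hends : R.wordEnd x (GRS.altWord j i m) = R.wordEnd x (GRS.altWord i j m) := by
    have h := R.wordEnd_reverse (R.wordEnd x (GRS.altWord i j m)) (GRS.altWord j i m).reverse
    rwa [← R.wordEnd_append x, ← GRS.altWord_two_mul, hend, List.reverse_reverse] at h
  have hid : R.wordLin x (GRS.altWord i j (2 * m)) = LinearMap.id := by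
    refine R.wordLin_eq_id hij (fun _ => GRS.mem_altWord) (by simp [GRS.altWord]) hend
      (fun v hv => ?_) fun v hv => ?_
    · rw [GRS.altWord_two_mul]
      exact R.wordLin_append_reverse_mem_pairPos (fun _ => GRS.mem_altWord) hends h₁ h₂ hv
    · rw [GRS.altWord_two_mul, List.reverse_append, List.reverse_reverse]
      exact R.wordLin_append_reverse_mem_pairPos (fun _ h => (GRS.mem_altWord h).symm)
        hends.symm h₂ h₁ hv
  rw [← R.coe_wordLin, hid]
  rfl
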